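/- For every positive integer m and every θ ∈ (0,1), L_m(θ) = L_{m+1}(θ) if and only if θ = φ_m²; that is, φ_m² is the unique root of the equation L_m(θ) = L_{m+1}(θ) in (0,1). -/

import Mathlib

open Classical in
/-- Asymptotic average code-length `L_m(θ)` of the modified Rice–Golomb code. -/
noncomputable def asympLen (m : ℕ) (θ : ℝ) : ℝ :=
  if ∃ β : ℕ, m = 2 ^ β then
    1 + Real.logb 2 m + θ ^ ((m : ℝ)/2) / (1 - θ ^ ((m : ℝ)/2))
  else
    1 + (Nat.log 2 m : ℝ) +
      θ ^ (((2 ^ Nat.clog 2 m - m : ℕ) : ℝ)/2) / (1 - θ ^ ((m : ℝ)/2))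

theorem sq_rpow_half {x : ℝ} (hx : 0 ≤ x) (n : ℕ) : (x ^ 2) ^ ((n : ℝ) / 2) = x ^ n := by
  rw [← Real.rpow_natCast x 2, ← Real.rpow_mul hx, ← Real.rpow_natCast x n]
  congr 1
  push_cast
  ring

/-- A single formula for the code-length on each closed dyadic block `[2 ^ k, 2 ^ (k + 1)]`. -/
theorem asympLen_sq_eq {k m : ℕ} (h₁ : 2 ^ k ≤ m) (h₂ : m ≤ 2 ^ (k + 1)) {x : ℝ}
    (hx₀ : 0 < x) (hx₁ : x < 1) :
    asympLen m (x ^ 2) = 1 + (k : ℝ) + x ^ (2 ^ (k + 1) - m) / (1 - x ^ m) := by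
  have hm : m ≠ 0 := (lt_of_lt_of_le (by positivity) h₁).ne'
  have hd : 1 - x ^ m ≠ 0 := (sub_pos.2 (pow_lt_one₀ hx₀.le hx₁ hm)).ne'
  unfold asympLen
  simp only [sq_rpow_half hx₀.le]
  split_ifs with h
  · obtain ⟨β, rfl⟩ := h
    have hlog : Real.logb 2 ((2 ^ β : ℕ) : ℝ) = β := by
      push_cast
      rw [Real.logb_pow, Real.logb_self_eq_one (by norm_num), mul_one]
    rw [hlog]
    have hkβ : k ≤ β := (Nat.pow_le_pow_iff_right (by norm_num)).1 h₁
    have hβk : β ≤ k + 1 := (Nat.pow_le_pow_iff_right (by norm_num)).1 h₂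
    obtain rfl | rfl : β = k ∨ β = k + 1 := by omega
    · rw [show 2 ^ (β + 1) - 2 ^ β = 2 ^ β by rw [pow_succ]; omega]
    · rw [Nat.sub_self, pow_zero]
      field_simp
      push_cast
      ring
  · have hlt : m < 2 ^ (k + 1) := lt_of_le_of_ne h₂ fun e => h ⟨_, e⟩
    have hgt : 2 ^ k < m := lt_of_le_of_ne h₁ fun e => h ⟨_, e.symm⟩
    have hlog : Nat.log 2 m = k := (Nat.log_eq_iff (by simp [hm])).2 ⟨h₁, hlt⟩
    have hclog : Nat.clog 2 m = k + 1 :=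
      le_antisymm ((Nat.clog_le_iff_le_pow (by norm_num)).2 h₂)
        ((Nat.lt_clog_iff_pow_lt (by norm_num)).2 hgt)
    rw [hlog, hclog]

theorem pow_add_pow_strictMonoOn {m : ℕ} (hm : m ≠ 0) :
    StrictMonoOn (fun x : ℝ => x ^ (m + 1) + x ^ m) (Set.Ici 0) := fun _ hx _ _ hxy =>
  add_lt_add (pow_lt_pow_left₀ hxy hx m.succ_ne_zero) (pow_lt_pow_left₀ hxy hx hm)

/-- `φ_m²` is the unique root of `L_m(θ) = L_{m+1}(θ)` in `(0,1)`. -/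
theorem intersection_point (m : ℕ) (hm : 0 < m) (φ : ℝ)
    (hφ : φ ∈ Set.Ioo (0:ℝ) 1 ∧ φ ^ (m + 1) + φ ^ m - 1 = 0) :
    ∀ θ ∈ Set.Ioo (0:ℝ) 1, (asympLen m θ = asympLen (m + 1) θ ↔ θ = φ ^ 2) := by
  obtain ⟨⟨hφ₀, hφ₁⟩, hφ⟩ := hφ
  rintro θ ⟨hθ₀, hθ₁⟩
  obtain ⟨x, hx₀, rfl⟩ : ∃ x : ℝ, 0 < x ∧ x ^ 2 = θ :=
    ⟨√θ, Real.sqrt_pos.2 hθ₀, Real.sq_sqrt hθ₀.le⟩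
  have hx₁ : x < 1 := by nlinarith
  have h₁ : 2 ^ Nat.log 2 m ≤ m := Nat.pow_log_le_self 2 hm.ne'
  have h₂ : m < 2 ^ (Nat.log 2 m + 1) := Nat.lt_pow_succ_log_self (by norm_num) m
  rw [asympLen_sq_eq h₁ h₂.le hx₀ hx₁, asympLen_sq_eq (by omega) h₂ hx₀ hx₁,
    pow_left_inj₀ hx₀.le hφ₀.le two_ne_zero, add_right_inj]
  obtain ⟨d, hd⟩ := Nat.exists_eq_add_of_lt h₂
  rw [show 2 ^ (Nat.log 2 m + 1) - m = d + 1 by omega,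
    show 2 ^ (Nat.log 2 m + 1) - (m + 1) = d by omega,
    div_eq_div_iff (sub_pos.2 (pow_lt_one₀ hx₀.le hx₁ hm.ne')).ne'
      (sub_pos.2 (pow_lt_one₀ hx₀.le hx₁ m.succ_ne_zero)).ne',
    ← (pow_add_pow_strictMonoOn hm.ne').injOn.eq_iff hx₀.le hφ₀.le]
  have hfactor : x ^ (d + 1) * (1 - x ^ (m + 1)) - x ^ d * (1 - x ^ m) =
      x ^ d * (1 - x) * (x ^ (m + 1) + x ^ m - 1) := by ring
  have hne : x ^ d * (1 - x) ≠ 0 := (mul_pos (pow_pos hx₀ d) (sub_pos.2 hx₁)).ne'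
  rw [← sub_eq_zero, hfactor, mul_eq_zero, or_iff_right hne]
  constructor <;> intro h <;> linarith
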